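/- Let τ be the involutive automorphism of B₄ defined by τ(w) = (ac)⁻¹ σ(w) (ac), where σ inverts the generators a, b, c, let J = B₄ ⋊_τ ℤ/2ℤ be the corresponding semidirect product, and let N be the normal closure in J of the element ((bac)⁴, 0). Then the automorphism group Aut(B₄) is isomorphic to the quotient group J/N. -/

import Mathlib

/-- Relators for the braid group `B₄ = ⟨a, b, c | aba = bab, bcb = cbc, ac = ca⟩`,
with generators indexed `0 ↦ a`, `1 ↦ b`, `2 ↦ c`. -/
def braidRels : Set (FreeGroup (Fin 3)) :=
  { FreeGroup.of 0 * FreeGroup.of 1 * FreeGroup.of 0 *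
      (FreeGroup.of 1 * FreeGroup.of 0 * FreeGroup.of 1)⁻¹,
    FreeGroup.of 1 * FreeGroup.of 2 * FreeGroup.of 1 *
      (FreeGroup.of 2 * FreeGroup.of 1 * FreeGroup.of 2)⁻¹,
    FreeGroup.of 0 * FreeGroup.of 2 * (FreeGroup.of 2 * FreeGroup.of 0)⁻¹ }

/-- The braid group on four strands. -/
abbrev B4 := PresentedGroup braidRels

namespace B4

def a : B4 := PresentedGroup.of 0
def b : B4 := PresentedGroup.of 1
def c : B4 := PresentedGroup.of 2
def d : B4 := (a * c)⁻¹ * b * (a * c)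
def e : B4 := a⁻¹ * b * a
def f : B4 := c⁻¹ * b * c
def x : B4 := b * a * c

end B4

open B4

/-! ### Combinatorics of the free group of rank two -/

section FreeGroupRankTwo

open FreeGroup (of lift mk mul_mk inv_mk invRev toWord toWord_mk mk_toWord isReduced_toWord
  toWord_eq_nil_iff toWord_mul_sublist reduce_singleton norm_mk_le)

/-- The cyclic permutation `u ↦ v ↦ u⁻¹ ↦ v⁻¹ ↦ u` of the signed letters of the free group of
rank two, where `u` and `v` are indexed by `false` and `true`. -/
def turnLetter (l : Bool × Bool) : Bool × Bool := (!l.1, l.1 ^^ l.2)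

/-- The automorphism `u ↦ v`, `v ↦ u⁻¹` of the free group of rank two. -/
def turn : MulAut (FreeGroup Bool) :=
  MonoidHom.toMulEquiv (lift fun i => bif i then (of false)⁻¹ else of true)
    (lift fun i => bif i then of false else (of true)⁻¹)
    (by ext i; cases i <;> simp) (by ext i; cases i <;> simp)

@[simp] lemma turn_of_false : turn (of false) = of true := by simp [turn]

@[simp] lemma turn_of_true : turn (of true) = (of false)⁻¹ := by simp [turn]

@[simp] lemma turn_symm_of_false : turn.symm (of false) = (of true)⁻¹ := by
  rw [MulEquiv.symm_apply_eq]
  simp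

@[simp] lemma turn_symm_of_true : turn.symm (of true) = of false := by
  rw [MulEquiv.symm_apply_eq]
  simp

lemma mulAut_ext {f g : MulAut (FreeGroup Bool)} (hu : f (of false) = g (of false))
    (hv : f (of true) = g (of true)) : f = g :=
  MulEquiv.toMonoidHom_injective (by ext i; cases i <;> assumption)

/-- The transvection `u ↦ u`, `v ↦ v * u⁻¹` of the free group of rank two. -/
def shear : MulAut (FreeGroup Bool) :=
  MonoidHom.toMulEquiv (lift fun i => bif i then of true * (of false)⁻¹ else of false)
    (lift fun i => bif i then of true * of false else of false)
    (by ext i; cases i <;> simp) (by ext i; cases i <;> simp)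

@[simp] lemma shear_of_false : shear (of false) = of false := by simp [shear]

@[simp] lemma shear_of_true : shear (of true) = of true * (of false)⁻¹ := by simp [shear]

lemma turn_mk (L : List (Bool × Bool)) : turn (mk L) = mk (L.map turnLetter) := by
  induction L with
  | nil => exact map_one turn
  | cons l L ih =>
    have h : turn (mk [l]) = mk [turnLetter l] := by
      rcases l with ⟨_ | _, _ | _⟩ <;> rfl
    rw [← List.singleton_append, ← mul_mk, map_mul, ih, h, mul_mk]
    rfl

lemma isReduced_map_turnLetter {L : List (Bool × Bool)} (h : FreeGroup.IsReduced L) :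
    FreeGroup.IsReduced (L.map turnLetter) := by
  rw [FreeGroup.IsReduced, List.isChain_map]
  refine List.IsChain.imp ?_ h
  decide

lemma eq_nil_of_mk_eq_one {L : List (Bool × Bool)} (hL : FreeGroup.IsReduced L)
    (h : (mk L : FreeGroup Bool) = 1) : L = [] := by
  have := toWord_eq_nil_iff.2 h
  rwa [toWord_mk, hL.reduce_eq] at this

lemma norm_mk_eq_length {L : List (Bool × Bool)} (hL : FreeGroup.IsReduced L) :
    (mk L : FreeGroup Bool).norm = L.length := by
  rw [FreeGroup.norm, toWord_mk, hL.reduce_eq]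

/-- The free group of rank two has trivial center. -/
lemma eq_one_of_forall_commute {w : FreeGroup Bool} (h : ∀ g, g * w = w * g) : w = 1 := by
  by_contra hw
  obtain ⟨m, W, hW⟩ := List.exists_cons_of_ne_nil (mt toWord_eq_nil_iff.1 hw)
  obtain ⟨l, hl, hlm⟩ : ∃ l : Bool × Bool, l ≠ m ∧ (l.1 = m.1 → l.2 = m.2) :=
    ⟨(!m.1, true), by simp [Prod.ext_iff], by simp⟩
  have hred : FreeGroup.IsReduced (l :: m :: W) :=
    List.isChain_cons_cons.2 ⟨hlm, hW ▸ isReduced_toWord⟩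
  have hleft : (mk [l] * w).toWord = l :: m :: W := by
    rw [← mk_toWord (x := w), hW, mul_mk, toWord_mk]
    exact hred.reduce_eq
  have hright := toWord_mul_sublist w (mk [l])
  rw [← h, hleft, toWord_mk, hW, reduce_singleton] at hright
  have := hright.eq_of_length (by simp)
  simp at this
  exact hl this.1

/-- A twisted form of Hilbert 90 for the cyclic group generated by `turn`. -/
lemma exists_eq_mul_turn {w : FreeGroup Bool}
    (h : w * turn w * turn (turn w) * turn (turn (turn w)) = 1) :
    ∃ g, w = g * turn g⁻¹ := by
  induction hn : w.norm using Nat.strong_induction_on generalizing w with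
  | _ n ih =>
  have hred : FreeGroup.IsReduced w.toWord := isReduced_toWord
  rcases hW : w.toWord with _ | ⟨l, W⟩
  · exact ⟨1, by simpa using toWord_eq_nil_iff.1 hW⟩
  have hw : w = mk (l :: W) := by rw [← hW, mk_toWord]
  rw [hW] at hred
  rcases List.eq_nil_or_concat' W with rfl | ⟨M, m, rfl⟩
  · exfalso
    rw [hw] at h
    revert h
    simp only [turn_mk, mul_mk]
    refine fun h => absurd (eq_nil_of_mk_eq_one ?_ h) (by simp)
    rcases l with ⟨_ | _, _ | _⟩ <;> simp [turnLetter]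
  by_cases hlm : turnLetter l = (m.1, !m.2)
  · have hmid : w = mk [l] * mk M * turn (mk [l])⁻¹ := by
      rw [map_inv, turn_mk, List.map_singleton, hlm, inv_mk, mul_mk, mul_mk, hw]
      simp [invRev]
    obtain ⟨g, hg⟩ := ih (mk M).norm (by
      have := norm_mk_eq_length hred
      have := norm_mk_le (L₁ := M)
      rw [← hw, hn] at *
      simp at *
      omega) (w := mk M) (by
        have h4 : turn (turn (turn (turn (mk [l])))) = mk [l] := by
          simp only [turn_mk]
          rcases l with ⟨_ | _, _ | _⟩ <;> rfl
        rw [hmid] at h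
        simp only [map_mul, map_inv, h4] at h
        generalize mk [l] = p at h
        rw [← conj_eq_one_iff (a := p)]
        simpa [mul_assoc] using h) rfl
    refine ⟨mk [l] * g, ?_⟩
    rw [hmid, hg]
    simp [mul_assoc]
  · exfalso
    rw [hw] at h
    simp only [turn_mk, mul_mk] at h
    refine absurd (eq_nil_of_mk_eq_one ?_ h) (by simp)
    have hr1 := isReduced_map_turnLetter hred
    have hr2 := isReduced_map_turnLetter hr1
    have hr3 := isReduced_map_turnLetter hr2
    refine (((List.IsChain.append hred hr1 ?_).append hr2 ?_).append hr3 ?_) <;>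
    · rcases l with ⟨_ | _, _ | _⟩ <;> rcases m with ⟨_ | _, _ | _⟩ <;>
        simp [turnLetter, List.getLast?_cons, List.getLast?_append] at hlm ⊢

/-- The power of `turnLetter` taking the letter `u` to `l`. -/
def rotateLetter : Bool × Bool → Bool × Bool → Bool × Bool
  | (false, true), m => m
  | (true, true), m => turnLetter m
  | (false, false), m => turnLetter (turnLetter m)
  | (true, false), m => turnLetter (turnLetter (turnLetter m))

lemma isReduced_flatMap_rotateLetter {P : List (Bool × Bool)} {m : Bool × Bool}
    (hP : FreeGroup.IsReduced P) (hfirst : P.head? = some m) (hlast : P.getLast? = some m)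
    {L : List (Bool × Bool)} (hL : FreeGroup.IsReduced L) :
    FreeGroup.IsReduced (L.flatMap fun l => P.map (rotateLetter l)) ∧
      (L.flatMap fun l => P.map (rotateLetter l)).head? =
        L.head?.map fun l => rotateLetter l m := by
  induction L with
  | nil => simp
  | cons l L ih =>
    have hL' : FreeGroup.IsReduced L := List.IsChain.tail hL
    obtain ⟨ih₁, ih₂⟩ := ih hL'
    refine ⟨?_, by simp [hfirst]⟩
    rw [List.flatMap_cons]
    refine List.IsChain.append ?_ ih₁ ?_
    · rw [List.isChain_map]
      refine List.IsChain.imp ?_ hP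
      clear * -
      revert l
      decide
    · rw [ih₂]
      cases L with
      | nil => simp
      | cons l' L =>
        have h := (List.isChain_cons_cons.1 hL).1
        simp only [List.getLast?_map, hlast, List.head?_cons, Option.map_some, Option.mem_some_iff,
          forall_eq']
        revert h
        clear * -
        revert l l' m
        decide

/-- An element `p` inverted by `turn ^ 2` which generates the free group of rank two together with
`turn p` is a letter. -/
lemma exists_eq_turn_pow {p : FreeGroup Bool} (hp : turn (turn p) = p⁻¹)
    (hgen : of false ∈ (lift fun i => bif i then turn p else p : FreeGroup Bool →* _).range) :
    ∃ k : ℕ, p = (turn ^ k) (of false) := by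
  obtain ⟨w, hw⟩ := hgen
  set P := p.toWord with hPdef
  have hpP : p = mk P := mk_toWord.symm
  have hP : FreeGroup.IsReduced P := isReduced_toWord
  have hmap (L : List (Bool × Bool)) :
      lift (fun i => bif i then turn p else p) (mk L) =
        mk (L.flatMap fun l => P.map (rotateLetter l)) := by
    induction L with
    | nil => exact map_one _
    | cons l L ih =>
      have h : lift (fun i => bif i then turn p else p) (mk [l]) = mk (P.map (rotateLetter l)) := by
        have hturn : turn p = mk (P.map turnLetter) := by rw [← turn_mk, ← hpP]
        have hturn₂ : p⁻¹ = mk (P.map (turnLetter ∘ turnLetter)) := by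
          rw [← hp, hturn, turn_mk, List.map_map]
        have hturn₃ : (turn p)⁻¹ = mk (P.map (turnLetter ∘ turnLetter ∘ turnLetter)) := by
          rw [← map_inv, hturn₂, turn_mk, List.map_map]
        rw [FreeGroup.lift_mk, List.map_singleton, List.prod_singleton]
        rcases l with ⟨_ | _, _ | _⟩
        exacts [hturn₂, hpP.trans (congrArg mk P.map_id.symm), hturn₃, hturn]
      rw [← List.singleton_append, ← mul_mk, _root_.map_mul, ih, h, mul_mk]
      rfl
  have hpal : P.getLast? = P.head? := by
    have h : P.map (fun m => (m.1, !m.2)) = (P.map fun m => (m.1, !m.2)).reverse := by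
      have hp' := congrArg toWord hp
      rw [FreeGroup.toWord_inv, hpP, turn_mk, turn_mk, toWord_mk, toWord_mk, hP.reduce_eq,
        (isReduced_map_turnLetter (isReduced_map_turnLetter hP)).reduce_eq, List.map_map] at hp'
      rw [← invRev, ← hp']
      exact List.map_congr_left fun m _ => by clear * -; revert m; decide
    have h' := congrArg List.head? h
    rw [List.head?_reverse, List.head?_map, List.getLast?_map] at h'
    refine (Option.map_injective ?_ h').symm
    rintro ⟨i, b⟩ ⟨j, b'⟩
    simp
  have hlen : (w.toWord.flatMap fun l => P.map (rotateLetter l)).length =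
      w.toWord.length * P.length := by
    simp [List.length_flatMap]
  rcases hPe : P with _ | ⟨m, M⟩
  · rw [hPe, List.length_nil, mul_zero, List.length_eq_zero_iff] at hlen
    rw [← mk_toWord (x := w), hmap, hPe, hlen] at hw
    exact absurd hw (FreeGroup.one_ne_of _)
  have hfirst : P.head? = some m := by simp [hPe]
  have hred := (isReduced_flatMap_rotateLetter hP hfirst (hpal.trans hfirst)
    (isReduced_toWord (x := w))).1
  have hone : w.toWord.length * P.length = 1 := by
    rw [← hlen, ← norm_mk_eq_length hred, ← hmap, mk_toWord, hw, FreeGroup.norm_of]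
  have hM : M = [] := by
    simpa [hPe] using Nat.eq_one_of_mul_eq_one_left hone
  rw [hpP, hPe, hM]
  rcases m with ⟨_ | _, _ | _⟩
  exacts [⟨2, rfl⟩, ⟨0, rfl⟩, ⟨3, rfl⟩, ⟨1, rfl⟩]

end FreeGroupRankTwo

/-! ### The braid group on four strands -/

namespace B4

lemma a_b_a : a * b * a = b * a * b :=
  PresentedGroup.mk_eq_mk_of_mul_inv_mem (by simp [braidRels])

lemma b_c_b : b * c * b = c * b * c :=
  PresentedGroup.mk_eq_mk_of_mul_inv_mem (by simp [braidRels])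

lemma a_c : a * c = c * a :=
  PresentedGroup.mk_eq_mk_of_mul_inv_mem (by simp [braidRels])

section Lift

variable {G : Type*} [Group G]

/-- The homomorphism out of the braid group determined by elements satisfying the braid
relations. -/
def lift (A B C : G) (hab : A * B * A = B * A * B) (hbc : B * C * B = C * B * C)
    (hac : A * C = C * A) : B4 →* G :=
  PresentedGroup.toGroup (f := ![A, B, C]) (by
    rintro r (rfl | rfl | rfl) <;> simp [*])

variable {A B C : G} {hab : A * B * A = B * A * B} {hbc : B * C * B = C * B * C}
  {hac : A * C = C * A}

@[simp] lemma lift_a : lift A B C hab hbc hac a = A := PresentedGroup.toGroup.of _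

@[simp] lemma lift_b : lift A B C hab hbc hac b = B := PresentedGroup.toGroup.of _

@[simp] lemma lift_c : lift A B C hab hbc hac c = C := PresentedGroup.toGroup.of _

lemma hom_ext {f g : B4 →* G} (ha : f a = g a) (hb : f b = g b) (hc : f c = g c) : f = g :=
  PresentedGroup.ext fun i => by fin_cases i <;> assumption

end Lift

lemma closure_eq_top : Subgroup.closure {a, b, c} = (⊤ : Subgroup B4) := by
  rw [← PresentedGroup.closure_range_of]
  congr 1
  ext g
  simp [Fin.exists_fin_succ, eq_comm, a, b, c]

/-- The Coxeter element `a * b * c`. -/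
def delta : B4 := a * b * c

lemma delta_mul_a : delta * a = b * delta := by
  calc a * b * c * a = a * b * (c * a) := mul_assoc _ _ _
    _ = a * b * a * c := by rw [← a_c]; group
    _ = b * (a * b * c) := by rw [a_b_a]; group

lemma delta_mul_b : delta * b = c * delta := by
  calc a * b * c * b = a * (b * c * b) := by group
    _ = a * c * b * c := by rw [b_c_b]; group
    _ = c * (a * b * c) := by rw [a_c]; group

lemma delta_sq_mul_c : delta * delta * c = a * (delta * delta) := by
  calc a * b * c * (a * b * c) * c = a * b * (c * a) * b * c * c := by group
    _ = a * b * a * (c * b * c) * c := by rw [← a_c]; group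
    _ = a * (b * a * b) * c * b * c := by rw [← b_c_b]; group
    _ = a * (a * b * (a * c) * b * c) := by rw [← a_b_a]; group
    _ = a * (a * b * c * (a * b * c)) := by rw [a_c]; group

lemma delta_conj_a : delta * a * delta⁻¹ = b := mul_inv_eq_iff_eq_mul.2 delta_mul_a

lemma delta_conj_b : delta * b * delta⁻¹ = c := mul_inv_eq_iff_eq_mul.2 delta_mul_b

lemma delta_sq_conj_c : delta * (delta * c * delta⁻¹) * delta⁻¹ = a := by
  have := mul_inv_eq_iff_eq_mul.2 delta_sq_mul_c
  rw [← this]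
  group

lemma closure_a_delta : Subgroup.closure {a, delta} = (⊤ : Subgroup B4) := by
  have ha : a ∈ Subgroup.closure {a, delta} := Subgroup.subset_closure (by simp)
  have hδ : delta ∈ Subgroup.closure {a, delta} := Subgroup.subset_closure (by simp)
  have hb : b ∈ Subgroup.closure {a, delta} :=
    delta_conj_a ▸ mul_mem (mul_mem hδ ha) (inv_mem hδ)
  have hc : c ∈ Subgroup.closure {a, delta} :=
    delta_conj_b ▸ mul_mem (mul_mem hδ hb) (inv_mem hδ)
  rw [eq_top_iff, ← closure_eq_top, Subgroup.closure_le]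
  rintro _ (rfl | rfl | rfl) <;> assumption

lemma delta_pow_four_mem_center : delta ^ 4 ∈ Subgroup.center B4 := by
  have h (g : B4) (hg : g = a ∨ g = delta) : g ∈ Subgroup.centralizer {delta ^ 4} := by
    rw [Subgroup.mem_centralizer_singleton_iff]
    rcases hg with rfl | rfl
    · have h : delta * (delta * (delta * (delta * a * delta⁻¹) * delta⁻¹) * delta⁻¹) * delta⁻¹
          = a := by rw [delta_conj_a, delta_conj_b, delta_sq_conj_c]
      calc a * delta ^ 4 = delta * (delta * (delta * (delta * a * delta⁻¹) * delta⁻¹) * delta⁻¹) *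
            delta⁻¹ * delta ^ 4 := by rw [h]
        _ = delta ^ 4 * a := by simp [pow_succ, mul_assoc]
    · group
  have htop : Subgroup.centralizer {delta ^ 4} = (⊤ : Subgroup B4) := by
    rw [eq_top_iff, ← closure_a_delta, Subgroup.closure_le]
    exact fun g hg => h g hg
  rw [Subgroup.mem_center_iff]
  intro g
  exact Subgroup.mem_centralizer_singleton_iff.1 (htop ▸ Subgroup.mem_top g)

lemma x_pow_four : x ^ 4 = delta ^ 4 := by
  have h : x = a⁻¹ * delta * a⁻¹⁻¹ := by
    rw [x, delta, mul_assoc, a_c]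
    group
  rw [h, conj_pow, Subgroup.mem_center_iff.1 delta_pow_four_mem_center a⁻¹]
  group

/-- The exponent sum homomorphism. -/
def exponent : B4 →* Multiplicative ℤ :=
  lift (.ofAdd 1) (.ofAdd 1) (.ofAdd 1) rfl rfl rfl

lemma exponent_delta : exponent delta = .ofAdd 3 := by
  simp [exponent, delta, ← ofAdd_add]

/-! ### The free normal subgroup -/

/-- The inclusion of the free normal subgroup of rank two generated by `a * c⁻¹` and its conjugate
by `delta`. -/
def freeHom : FreeGroup Bool →* B4 :=
  FreeGroup.lift fun i => bif i then delta * (a * c⁻¹) * delta⁻¹ else a * c⁻¹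

@[simp] lemma freeHom_of_false : freeHom (.of false) = a * c⁻¹ := by simp [freeHom]

@[simp] lemma freeHom_of_true : freeHom (.of true) = delta * (a * c⁻¹) * delta⁻¹ := by
  simp [freeHom]

/-- The action of the braid group on its free normal subgroup of rank two. -/
def action : B4 →* MulAut (FreeGroup Bool) :=
  lift shear (turn * shear * turn⁻¹) (turn * (turn * shear * turn⁻¹) * turn⁻¹)
    (mulAut_ext (by simp) (by simp [mul_assoc])) (mulAut_ext (by simp [mul_assoc]) (by simp))
    (mulAut_ext (by simp) (by simp [mul_assoc]))

@[simp] lemma action_a : action a = shear := lift_a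

@[simp] lemma action_b : action b = turn * shear * turn⁻¹ := lift_b

@[simp] lemma action_c : action c = turn * (turn * shear * turn⁻¹) * turn⁻¹ := lift_c

@[simp] lemma action_delta : action delta = turn := by
  simp only [delta, map_mul, action_a, action_b, action_c]
  exact mulAut_ext (by simp) (by simp)

lemma freeHom_turn (w : FreeGroup Bool) : freeHom (turn w) = delta * freeHom w * delta⁻¹ := by
  have h : freeHom.comp turn.toMonoidHom = (MulAut.conj delta).toMonoidHom.comp freeHom := by
    ext i
    cases i
    · simp
    · have h₁ : delta * (delta * a * delta⁻¹) * delta⁻¹ = c := by rw [delta_conj_a, delta_conj_b]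
      have h₂ := delta_sq_conj_c
      simp only [MonoidHom.comp_apply, MulEquiv.toMonoidHom_eq_coe, MonoidHom.coe_coe, turn_of_true,
        map_inv, freeHom_of_false, MulAut.conj_apply, freeHom_of_true]
      calc (a * c⁻¹)⁻¹ = c * a⁻¹ := by group
        _ = delta * (delta * a * delta⁻¹) * delta⁻¹ *
            (delta * (delta * c * delta⁻¹) * delta⁻¹)⁻¹ := by rw [h₁, h₂]
        _ = _ := by group
  exact DFunLike.congr_fun h w

lemma delta_conj_a_c_inv : delta * (a * c⁻¹) * delta⁻¹ = a * b * a * c⁻¹ * b⁻¹ * a⁻¹ := by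
  calc delta * (a * c⁻¹) * delta⁻¹ = delta * a * c⁻¹ * delta⁻¹ := by group
    _ = b * a * b * c⁻¹ * b⁻¹ * a⁻¹ := by rw [delta_mul_a, delta]; group
    _ = _ := by rw [a_b_a]

lemma freeHom_shear (w : FreeGroup Bool) : freeHom (shear w) = a * freeHom w * a⁻¹ := by
  have h : freeHom.comp shear.toMonoidHom = (MulAut.conj a).toMonoidHom.comp freeHom := by
    ext i
    cases i
    · simp only [MonoidHom.comp_apply, MulEquiv.toMonoidHom_eq_coe, MonoidHom.coe_coe,
        shear_of_false, freeHom_of_false, MulAut.conj_apply]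
      rw [mul_assoc a (a * c⁻¹), mul_assoc a c⁻¹, ← mul_inv_rev, a_c]
      group
    · have h : b * c⁻¹ * b⁻¹ = c⁻¹ * b⁻¹ * c := by
        calc b * c⁻¹ * b⁻¹ = c⁻¹ * b⁻¹ * (b * c * b) * c⁻¹ * b⁻¹ := by group
          _ = c⁻¹ * b⁻¹ * c := by rw [b_c_b]; group
      have h' : c * a⁻¹ = a⁻¹ * c := by
        calc c * a⁻¹ = a⁻¹ * (a * c) * a⁻¹ := by group
          _ = a⁻¹ * c := by rw [a_c]; group
      simp only [MonoidHom.comp_apply, MulEquiv.toMonoidHom_eq_coe, MonoidHom.coe_coe,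
        shear_of_true, map_mul, map_inv, freeHom_of_false, freeHom_of_true, delta_conj_a_c_inv,
        MulAut.conj_apply]
      calc a * b * a * c⁻¹ * b⁻¹ * a⁻¹ * (a * c⁻¹)⁻¹
          = a * b * a * c⁻¹ * b⁻¹ * a⁻¹ * (c * a⁻¹) := by group
        _ = a * b * a * (c⁻¹ * b⁻¹ * c) * a⁻¹ * a⁻¹ := by
          rw [mul_assoc _ a⁻¹, ← mul_assoc a⁻¹, ← h']
          group
        _ = a * (b * a * b) * c⁻¹ * b⁻¹ * a⁻¹ * a⁻¹ := by rw [← h]; group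
        _ = _ := by rw [← a_b_a]; group
  exact DFunLike.congr_fun h w

lemma freeHom_action (g : B4) (w : FreeGroup Bool) :
    freeHom (action g w) = g * freeHom w * g⁻¹ := by
  induction closure_a_delta ▸ Subgroup.mem_top g using Subgroup.closure_induction
    generalizing w with
  | mem g hg =>
    rcases hg with rfl | rfl
    · rw [action_a, freeHom_shear]
    · rw [action_delta, freeHom_turn]
  | one => simp
  | mul g h _ _ hg hh => rw [map_mul, MulAut.mul_apply, hg, hh]; group
  | inv g _ hg =>
    have h := hg (action g⁻¹ w)
    rw [← MulAut.mul_apply, ← map_mul, mul_inv_cancel, map_one, MulAut.one_apply] at h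
    rw [h]
    group

lemma action_freeHom (w : FreeGroup Bool) : action (freeHom w) = MulAut.conj w := by
  have hu : action (a * c⁻¹) = MulAut.conj (.of false) := by
    rw [map_mul, map_inv, action_a, action_c, mul_inv_eq_iff_eq_mul]
    exact mulAut_ext (by simp) (by simp [mul_assoc])
  have h : action.comp freeHom = MulAut.conj := by
    ext1 i
    cases i
    · simpa using hu
    · rw [MonoidHom.comp_apply, freeHom_of_true, map_mul, map_mul, hu, map_inv, action_delta,
        mul_inv_eq_iff_eq_mul]
      ext1 w
      simp
  exact DFunLike.congr_fun h w

lemma freeHom_injective : Function.Injective freeHom := by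
  rw [injective_iff_map_eq_one]
  intro w hw
  refine eq_one_of_forall_commute fun g => ?_
  have h := DFunLike.congr_fun (action_freeHom w) g
  rw [hw, map_one, MulAut.one_apply, MulAut.conj_apply, eq_mul_inv_iff_mul_eq] at h
  exact h

instance normal_range_freeHom : freeHom.range.Normal where
  conj_mem := by
    rintro _ ⟨w, rfl⟩ g
    exact ⟨action g w, freeHom_action g w⟩

lemma exponent_freeHom (w : FreeGroup Bool) : exponent (freeHom w) = 1 := by
  have h : exponent.comp freeHom = 1 := by
    ext i
    cases i <;> simp [exponent]
  exact DFunLike.congr_fun h w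

/-! ### The representation in `SL(2, ℤ)` -/

open Matrix in
/-- The action of the braid group on the abelianization of its free normal subgroup. -/
def rep : B4 →* SpecialLinearGroup (Fin 2) ℤ :=
  lift ⟨!![1, -1; 0, 1], by simp⟩ ⟨!![1, 0; 1, 1], by simp⟩ ⟨!![1, -1; 0, 1], by simp⟩
    (by decide) (by decide) rfl

lemma rep_a : (rep a : Matrix (Fin 2) (Fin 2) ℤ) = !![1, -1; 0, 1] :=
  congrArg Subtype.val (show rep a = ⟨!![1, -1; 0, 1], by simp⟩ from lift_a)

lemma rep_b : (rep b : Matrix (Fin 2) (Fin 2) ℤ) = !![1, 0; 1, 1] :=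
  congrArg Subtype.val (show rep b = ⟨!![1, 0; 1, 1], by simp⟩ from lift_b)

lemma rep_c : rep c = rep a := lift_c.trans lift_a.symm

lemma rep_delta : (rep delta : Matrix (Fin 2) (Fin 2) ℤ) = !![0, -1; 1, 0] := by
  simp [delta, rep_a, rep_b, rep_c]

lemma rep_freeHom (w : FreeGroup Bool) : rep (freeHom w) = 1 := by
  have h : rep.comp freeHom = 1 := by
    ext1 i
    cases i <;> simp [rep_c]
  exact DFunLike.congr_fun h w

lemma rep_delta_pow_four : rep delta ^ 4 = 1 := by
  ext1
  simp [rep_delta, pow_succ, Matrix.one_fin_two]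

lemma rep_delta_zpow_cases (n : ℤ) :
    (4 ∣ n ∧ (rep delta ^ n : Matrix.SpecialLinearGroup (Fin 2) ℤ) = 1) ∨
      ((rep delta ^ n : Matrix.SpecialLinearGroup (Fin 2) ℤ) 0 0 ≤ 0) := by
  have hpow (k : ℤ) (r : ℕ) : rep delta ^ (4 * k + r) = rep delta ^ r := by
    rw [zpow_add, zpow_mul, zpow_natCast, show (4 : ℤ) = (4 : ℕ) from rfl, zpow_natCast,
      rep_delta_pow_four, one_zpow, one_mul]
  obtain ⟨k, h⟩ : ∃ k : ℤ, n = 4 * k + (0 : ℕ) ∨ n = 4 * k + (1 : ℕ) ∨ n = 4 * k + (2 : ℕ) ∨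
      n = 4 * k + (3 : ℕ) := ⟨n / 4, by omega⟩
  rcases h with rfl | rfl | rfl | rfl <;> rw [hpow]
  · exact Or.inl ⟨⟨k, by simp⟩, pow_zero _⟩
  all_goals exact Or.inr (by simp [rep_delta, pow_succ])

/-- Coordinates on the abelianization of the free group of rank two. -/
def abelianCoords : FreeGroup Bool →* Multiplicative (Fin 2 → ℤ) :=
  FreeGroup.lift fun i => .ofAdd (bif i then ![0, 1] else ![1, 0])

lemma abelianCoords_action (g : B4) (w : FreeGroup Bool) :
    (abelianCoords (action g w)).toAdd =
      (rep g : Matrix (Fin 2) (Fin 2) ℤ).mulVec (abelianCoords w).toAdd := by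
  have hom {g : B4} (h : ∀ i, (abelianCoords (action g (.of i))).toAdd =
      (rep g : Matrix (Fin 2) (Fin 2) ℤ).mulVec (abelianCoords (.of i)).toAdd)
      (w : FreeGroup Bool) : (abelianCoords (action g w)).toAdd =
      (rep g : Matrix (Fin 2) (Fin 2) ℤ).mulVec (abelianCoords w).toAdd := by
    induction w using FreeGroup.induction_on with
    | C1 => simp
    | of i => exact h i
    | inv_of i hi => simp [Matrix.mulVec_neg, hi]
    | mul v w hv hw => simp [Matrix.mulVec_add, hv, hw]
  induction closure_a_delta ▸ Subgroup.mem_top g using Subgroup.closure_induction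
    generalizing w with
  | mem g hg =>
    refine hom (fun i => ?_) w
    rcases hg with rfl | rfl <;> cases i <;>
      simp [abelianCoords, rep_a, rep_delta] <;> decide
  | one => simp
  | mul g h _ _ hg hh =>
    rw [map_mul, MulAut.mul_apply, hg, hh, map_mul, Matrix.SpecialLinearGroup.coe_mul,
      Matrix.mulVec_mulVec]
  | inv g _ hg =>
    have h := hg (action g⁻¹ w)
    rw [← MulAut.mul_apply, ← map_mul, mul_inv_cancel, map_one, MulAut.one_apply] at h
    rw [h, Matrix.mulVec_mulVec, ← Matrix.SpecialLinearGroup.coe_mul, ← map_mul]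
    simp

lemma rep_eq_one_of_action_eq_one {g : B4} (hg : action g = 1) : rep g = 1 := by
  have hu := abelianCoords_action g (.of false)
  have hv := abelianCoords_action g (.of true)
  rw [hg] at hu hv
  have hu₀ := congrFun hu 0
  have hu₁ := congrFun hu 1
  have hv₀ := congrFun hv 0
  have hv₁ := congrFun hv 1
  simp [abelianCoords, Matrix.mulVec, dotProduct, Fin.sum_univ_two] at hu₀ hu₁ hv₀ hv₁
  ext i j
  fin_cases i <;> fin_cases j <;> simp [← hu₀, ← hu₁, ← hv₀, ← hv₁]

section NormalForm

variable {G : Type*} [Group G] {s p q : G}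

lemma exists_zpow_mul_mul_zpow (hp : s * p = q * s) (hq : s * q = p * s) (hs : p * q * p = s)
    {g : G} (hg : g ∈ Subgroup.closure {p, s}) :
    ∃ i j : ℤ, ∃ m ∈ Submonoid.closure {q, p⁻¹}, g = s ^ i * m * s ^ j := by
  have hqm : q ∈ Submonoid.closure {q, p⁻¹} := Submonoid.subset_closure (by simp)
  have hpm : p⁻¹ ∈ Submonoid.closure {q, p⁻¹} := Submonoid.subset_closure (by simp)
  have hswap (i : ℤ) : (p * s ^ i = s ^ i * p ∧ q * s ^ i = s ^ i * q) ∨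
      (p * s ^ i = s ^ i * q ∧ q * s ^ i = s ^ i * p) := by
    induction i with
    | zero => simp
    | succ i ih =>
      rw [zpow_add_one, ← mul_assoc, ← mul_assoc]
      rcases ih with ⟨h₁, h₂⟩ | ⟨h₁, h₂⟩ <;> rw [h₁, h₂] <;> simp [mul_assoc, hp, hq]
    | pred i ih =>
      have hp' : p * s⁻¹ = s⁻¹ * q := by
        rw [mul_inv_eq_iff_eq_mul, mul_assoc, ← hp, inv_mul_cancel_left]
      have hq' : q * s⁻¹ = s⁻¹ * p := by
        rw [mul_inv_eq_iff_eq_mul, mul_assoc, ← hq, inv_mul_cancel_left]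
      rw [zpow_sub_one, ← mul_assoc, ← mul_assoc]
      rcases ih with ⟨h₁, h₂⟩ | ⟨h₁, h₂⟩ <;> rw [h₁, h₂] <;> simp [mul_assoc, hp', hq']
  have hqpq : q⁻¹ * p⁻¹ = s⁻¹ * q := by
    rw [eq_inv_mul_iff_mul_eq, ← mul_inv_rev, mul_inv_eq_iff_eq_mul,
      ← mul_right_cancel_iff (a := p), hp, ← hs]
    group
  have hmulp (m : G) (hm : m ∈ Submonoid.closure {q, p⁻¹}) :
      ∃ i j : ℤ, ∃ m' ∈ Submonoid.closure {q, p⁻¹}, p * m = s ^ i * m' * s ^ j := by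
    induction hm using Submonoid.closure_induction_left with
    | one => exact ⟨1, -1, q, hqm, by simp [hq]⟩
    | mul_left y hy m hm _ =>
      obtain hy | hy : y = q ∨ y = p⁻¹ := hy
      · refine ⟨1, 0, p⁻¹ * m, mul_mem hpm hm, ?_⟩
        rw [← hs, hy]
        simp [mul_assoc]
      · exact ⟨0, 0, m, hm, by simp [hy]⟩
  have hmulq (m : G) (hm : m ∈ Submonoid.closure {q, p⁻¹}) :
      ∃ i j : ℤ, ∃ m' ∈ Submonoid.closure {q, p⁻¹}, q⁻¹ * m = s ^ i * m' * s ^ j := by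
    induction hm using Submonoid.closure_induction_left with
    | one =>
      refine ⟨1, -1, p⁻¹, hpm, ?_⟩
      rw [← inv_inj]
      simp [← mul_assoc, hp]
    | mul_left y hy m hm _ =>
      obtain hy | hy : y = q ∨ y = p⁻¹ := hy
      · exact ⟨0, 0, m, hm, by simp [hy]⟩
      · exact ⟨-1, 0, q * m, mul_mem hqm hm, by simp [hy, ← mul_assoc, hqpq]⟩
  have hcomb {g : G} (hg : ∃ i j : ℤ, ∃ m ∈ Submonoid.closure {q, p⁻¹}, g = s ^ i * m * s ^ j)
      (k l : ℤ) : ∃ i j : ℤ, ∃ m ∈ Submonoid.closure {q, p⁻¹},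
        s ^ k * g * s ^ l = s ^ i * m * s ^ j := by
    obtain ⟨i, j, m, hm, rfl⟩ := hg
    exact ⟨k + i, j + l, m, hm, by simp only [zpow_add, mul_assoc]⟩
  induction hg using Subgroup.closure_induction_left with
  | one => exact ⟨0, 0, 1, one_mem _, by simp⟩
  | mul_left y hy g _ ih =>
    obtain ⟨i, j, m, hm, rfl⟩ := ih
    obtain hy | hy : y = p ∨ y = s := hy
    · rcases hswap i with ⟨h, -⟩ | ⟨h, -⟩
      · have h' : y * (s ^ i * m * s ^ j) = s ^ i * (p * m) * s ^ j := by
          simp only [hy, ← mul_assoc, h]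
        rw [h']
        exact hcomb (hmulp m hm) i j
      · exact ⟨i, j, q * m, mul_mem hqm hm, by simp only [hy, ← mul_assoc, h]⟩
    · exact ⟨i + 1, j, m, hm, by rw [hy, add_comm, zpow_one_add]; simp only [mul_assoc]⟩
  | inv_mul_cancel y hy g _ ih =>
    obtain ⟨i, j, m, hm, rfl⟩ := ih
    obtain hy | hy : y = p ∨ y = s := hy
    · rcases hswap i with ⟨h, -⟩ | ⟨h, -⟩
      · have h' : p⁻¹ * s ^ i = s ^ i * p⁻¹ := by
          rw [inv_mul_eq_iff_eq_mul, ← mul_assoc, h, mul_inv_cancel_right]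
        exact ⟨i, j, p⁻¹ * m, mul_mem hpm hm, by simp only [hy, ← mul_assoc, h']⟩
      · have h' : p⁻¹ * s ^ i = s ^ i * q⁻¹ := by
          rw [inv_mul_eq_iff_eq_mul, ← mul_assoc, eq_mul_inv_iff_mul_eq, h]
        have h'' : y⁻¹ * (s ^ i * m * s ^ j) = s ^ i * (q⁻¹ * m) * s ^ j := by
          simp only [hy, ← mul_assoc, h']
        rw [h'']
        exact hcomb (hmulq m hm) i j
    · exact ⟨i - 1, j, m, hm, by
        rw [hy, sub_eq_neg_add, zpow_add, zpow_neg_one]; simp only [mul_assoc]⟩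

end NormalForm

lemma rep_pos {m : B4} (hm : m ∈ Submonoid.closure {b, a⁻¹}) :
    1 ≤ rep m 0 0 ∧ 1 ≤ rep m 1 1 ∧ 0 ≤ rep m 0 1 ∧ 0 ≤ rep m 1 0 ∧
      (m = 1 ∨ 1 ≤ rep m 0 1 + rep m 1 0) := by
  induction hm using Submonoid.closure_induction_left with
  | one => simp
  | mul_left y hy m _ ih =>
    rcases hy with rfl | rfl <;>
      simp [rep_a, rep_b, Matrix.SpecialLinearGroup.coe_inv, Matrix.adjugate_fin_two,
        Matrix.mul_apply, Fin.sum_univ_two] <;> omega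

lemma exists_eq_of_rep_eq_one {g : B4} (hg : rep g = 1) :
    ∃ k : ℤ, ∃ w, g = delta ^ (4 * k) * freeHom w := by
  let π := QuotientGroup.mk' freeHom.range
  have hc : π c = π a := by
    refine (QuotientGroup.eq_iff_div_mem.2 ⟨.of false, ?_⟩ : (a : B4 ⧸ freeHom.range) = c).symm
    rw [freeHom_of_false, div_eq_mul_inv]
  obtain ⟨i, j, m, hm, h⟩ := exists_zpow_mul_mul_zpow
    (g := π g) (s := π delta) (p := π a) (q := π b)
    (by rw [← map_mul, delta_mul_a, map_mul])
    (by rw [← map_mul, delta_mul_b, map_mul, hc])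
    (by rw [delta, map_mul, map_mul, hc])
    (by
      rw [← Set.image_pair, ← MonoidHom.map_closure, closure_a_delta]
      exact Subgroup.mem_map_of_mem _ (Subgroup.mem_top g))
  rw [← map_inv, ← Set.image_pair, ← MonoidHom.map_mclosure] at hm
  obtain ⟨m, hm, rfl⟩ := hm
  rw [← map_zpow, ← map_zpow, ← map_mul, ← map_mul, eq_comm] at h
  obtain ⟨w, hw⟩ := QuotientGroup.eq.1 h
  have hgw : g = delta ^ i * m * delta ^ j * freeHom w := by rw [hw]; group
  have hrep : rep m = rep delta ^ (-i - j) := by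
    have h := congrArg rep hgw
    rw [hg, map_mul, rep_freeHom, map_mul, map_mul, map_zpow, map_zpow, mul_one] at h
    calc rep m = rep delta ^ (-i) * (rep delta ^ i * rep m * rep delta ^ j) * rep delta ^ (-j) := by
          group
      _ = _ := by rw [← h]; group
  obtain ⟨h00, -, -, -, hm⟩ := rep_pos hm
  rcases rep_delta_zpow_cases (-i - j) with ⟨⟨k, hk⟩, h₁⟩ | h₀
  · rw [h₁] at hrep
    have : m = 1 := by simpa [hrep] using hm
    refine ⟨-k, w, ?_⟩
    rw [hgw, this, mul_one, ← zpow_add]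
    congr 2
    omega
  · rw [← hrep] at h₀
    omega

lemma exists_eq_of_forall_commute {g : B4} (hg : ∀ w, g * freeHom w * g⁻¹ = freeHom w) :
    ∃ k : ℤ, g = delta ^ (4 * k) := by
  have h : action g = 1 := by
    ext1 w
    exact freeHom_injective (by rw [freeHom_action, hg, MulAut.one_apply])
  obtain ⟨k, w, rfl⟩ := exists_eq_of_rep_eq_one (rep_eq_one_of_action_eq_one h)
  have hw : w = 1 := by
    refine eq_one_of_forall_commute fun v => ?_
    have hδ := Subgroup.mem_center_iff.1 (zpow_mem delta_pow_four_mem_center k) (freeHom v)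
    have h := hg v
    apply freeHom_injective
    rw [← zpow_natCast, ← zpow_mul, Nat.cast_ofNat] at hδ
    rw [mul_inv_eq_iff_eq_mul, mul_assoc, ← mul_assoc (freeHom v), hδ, mul_assoc,
      mul_right_inj, ← map_mul, ← map_mul] at h
    exact congrArg freeHom (freeHom_injective h).symm
  exact ⟨k, by simp [hw]⟩

lemma mem_center_iff {g : B4} : g ∈ Subgroup.center B4 ↔ ∃ k : ℤ, g = delta ^ (4 * k) := by
  constructor
  · intro hg
    refine exists_eq_of_forall_commute fun w => ?_
    rw [← Subgroup.mem_center_iff.1 hg, mul_inv_cancel_right]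
  · rintro ⟨k, rfl⟩
    rw [zpow_mul]
    exact zpow_mem (mod_cast delta_pow_four_mem_center) k

lemma exponent_delta_zpow (n : ℤ) : exponent (delta ^ n) = .ofAdd (3 * n) := by
  rw [map_zpow, exponent_delta, ← ofAdd_zsmul, smul_eq_mul, mul_comm]

end B4

section SpecialLinearGroup

open Matrix

variable {A B C : SpecialLinearGroup (Fin 2) ℤ}

lemma trace_conj (A B : SpecialLinearGroup (Fin 2) ℤ) :
    (A * B * A⁻¹).1.trace = B.1.trace :=
  calc (A * B * A⁻¹).1.trace = ((A * B).1 * A⁻¹.1).trace := rfl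
    _ = (A⁻¹.1 * (A * B).1).trace := trace_mul_comm _ _
    _ = (A⁻¹ * (A * B)).1.trace := rfl
    _ = B.1.trace := congrArg (fun M : SpecialLinearGroup (Fin 2) ℤ => M.1.trace) (by group)

lemma trace_eq_trace_of_braid (h : A * B * A = B * A * B) :
    (A : Matrix (Fin 2) (Fin 2) ℤ).trace = (B : Matrix (Fin 2) (Fin 2) ℤ).trace := by
  have hB : A * B * A * (A * B)⁻¹ = B := by
    rw [h]
    group
  exact (trace_conj (A * B) A).symm.trans
    (congrArg (fun M : SpecialLinearGroup (Fin 2) ℤ => M.1.trace) hB)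

lemma trace_mul_eq_one_of_braid (h : A * B * A = B * A * B) (hne : A ≠ B) :
    (A * B : Matrix (Fin 2) (Fin 2) ℤ).trace = 1 := by
  by_contra hs
  refine hne (Subtype.ext ?_)
  have ht := trace_eq_trace_of_braid h
  have hA := A.det_coe
  have hB := B.det_coe
  have h' : (A * B * A : Matrix (Fin 2) (Fin 2) ℤ) = B * A * B := by
    simpa using congrArg (fun M : SpecialLinearGroup (Fin 2) ℤ => M.1) h
  have key (i j : Fin 2) : ((A * B : Matrix (Fin 2) (Fin 2) ℤ).trace - 1) * (A i j - B i j) =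
      0 := by
    have h := congrFun₂ h' i j
    rw [det_fin_two] at hA hB
    simp only [trace_fin_two, mul_apply, Fin.sum_univ_two] at h ht ⊢
    fin_cases i <;> fin_cases j <;> simp only [Fin.mk_one, Fin.zero_eta, Fin.isValue] at h ⊢
    · linear_combination h + B 1 1 * hA - A 1 1 * hB - ht
    · linear_combination h - B 0 1 * hA + A 0 1 * hB
    · linear_combination h - B 1 0 * hA + A 1 0 * hB
    · linear_combination h + B 0 0 * hA - A 0 0 * hB - ht
  ext i j
  exact sub_eq_zero.1 ((mul_eq_zero.1 (key i j)).resolve_left (sub_ne_zero.2 hs))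

/-- If two commuting matrices are both in the braid relation with a third one, then they agree. -/
lemma eq_of_braid (hab : A * B * A = B * A * B) (hbc : B * C * B = C * B * C)
    (hac : A * C = C * A) : C = A := by
  by_cases h₁ : A = B
  · subst h₁
    rw [hac] at hbc
    exact (mul_left_cancel hbc).symm
  by_cases h₂ : B = C
  · subst h₂
    rw [hac] at hab
    exact (mul_left_cancel hab).symm
  have htab := trace_eq_trace_of_braid hab
  have htbc := trace_eq_trace_of_braid hbc
  have hsab := trace_mul_eq_one_of_braid hab h₁
  have hsbc := trace_mul_eq_one_of_braid hbc h₂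
  have hac' : (A * C : Matrix (Fin 2) (Fin 2) ℤ) = C * A := by
    simpa using congrArg (fun M : SpecialLinearGroup (Fin 2) ℤ => M.1) hac
  have h00 := congrFun₂ hac' 0 0
  have h01 := congrFun₂ hac' 0 1
  have h10 := congrFun₂ hac' 1 0
  have hA := A.det_coe
  have hB := B.det_coe
  rw [det_fin_two] at hA hB
  simp only [trace_fin_two, mul_apply, Fin.sum_univ_two] at htab htbc hsab hsbc h00 h01 h10
  have hE : C 1 1 - A 1 1 = -(C 0 0 - A 0 0) := by linarith
  have hEB : (C 0 0 - A 0 0) * (B 0 0 - B 1 1) + (C 0 1 - A 0 1) * B 1 0 +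
      (C 1 0 - A 1 0) * B 0 1 = 0 := by
    linear_combination hsbc - hsab - B 1 1 * hE
  have hAB : (A 0 0 - A 1 1) * (B 0 0 - B 1 1) + 2 * A 0 1 * B 1 0 + 2 * A 1 0 * B 0 1 =
      2 - (A 0 0 + A 1 1) ^ 2 := by
    linear_combination 2 * hsab + (A 0 0 + A 1 1) * htab
  have h01' : (A 0 0 - A 1 1) * (C 0 1 - A 0 1) = 2 * A 0 1 * (C 0 0 - A 0 0) := by
    linear_combination h01 - A 0 1 * hE
  have h10' : (A 0 0 - A 1 1) * (C 1 0 - A 1 0) = 2 * A 1 0 * (C 0 0 - A 0 0) := by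
    linear_combination -h10 - A 1 0 * hE
  have key00 : (2 - (A 0 0 + A 1 1) ^ 2) * (C 0 0 - A 0 0) = 0 := by
    linear_combination -(C 0 0 - A 0 0) * hAB + (A 0 0 - A 1 1) * hEB - B 1 0 * h01' - B 0 1 * h10'
  have key (i j : Fin 2) : (2 - (A 0 0 + A 1 1) ^ 2) * (C i j - A i j) = 0 := by
    fin_cases i <;> fin_cases j <;> simp only [Fin.mk_one, Fin.zero_eta, Fin.isValue]
    · exact key00
    · linear_combination -(C 0 1 - A 0 1) * hAB + 2 * A 0 1 * hEB + (B 0 0 - B 1 1) * h01' -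
        2 * B 0 1 * h00
    · linear_combination -(C 1 0 - A 1 0) * hAB + 2 * A 1 0 * hEB + (B 0 0 - B 1 1) * h10' +
        2 * B 1 0 * h00
    · linear_combination (2 - (A 0 0 + A 1 1) ^ 2) * hE - key00
  have hne : 2 - (A 0 0 + A 1 1) ^ 2 ≠ 0 := by
    generalize A 0 0 + A 1 1 = t
    intro ht
    have h₁ : t < 2 := by nlinarith
    have h₂ : -2 < t := by nlinarith
    interval_cases t <;> omega
  ext i j
  exact sub_eq_zero.1 ((mul_eq_zero.1 (key i j)).resolve_left hne)

end SpecialLinearGroup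

namespace B4

open Matrix in
lemma exists_rep_conj_eq_of_trace_eq_zero (M : SpecialLinearGroup (Fin 2) ℤ)
    (hM : M 1 1 = -M 0 0) :
    ∃ h : B4, ∃ i : ℤ, rep h * M * (rep h)⁻¹ = rep delta ^ i := by
  induction hn : (M 0 0).natAbs using Nat.strong_induction_on generalizing M with
  | _ n ih =>
    have hdet := M.det_coe
    rw [det_fin_two, hM] at hdet
    by_cases h0 : M 0 0 = 0
    · have h : M 0 1 * M 1 0 = -1 := by rw [h0] at hdet; linarith
      rcases Int.mul_eq_neg_one_iff_eq_one_or_neg_one.1 h with ⟨h01, h10⟩ | ⟨h01, h10⟩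
      · refine ⟨1, -1, ?_⟩
        ext i j
        fin_cases i <;> fin_cases j <;>
          simp [h01, h10, hM, h0, rep_delta, adjugate_fin_two]
      · refine ⟨1, 1, ?_⟩
        ext i j
        fin_cases i <;> fin_cases j <;> simp [h01, h10, hM, h0, rep_delta]
    · obtain ⟨g, hg, hg'⟩ : ∃ g : B4, (rep g * M * (rep g)⁻¹) 1 1 = -(rep g * M * (rep g)⁻¹) 0 0 ∧
          ((rep g * M * (rep g)⁻¹) 0 0).natAbs < n := by
        have hprod : M 0 1 * M 1 0 = -(M 0 0 ^ 2 + 1) := by linear_combination -hdet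
        have hlt : (M 0 1).natAbs ≤ (M 0 0).natAbs ∨ (M 1 0).natAbs ≤ (M 0 0).natAbs := by
          by_contra! hcon
          zify at hcon
          have h : |M 0 1| * |M 1 0| = |M 0 0| ^ 2 + 1 := by
            rw [← abs_mul, hprod, abs_neg, sq_abs, abs_of_pos (by positivity)]
          have h' : (|M 0 0| + 1) * (|M 0 0| + 1) ≤ |M 0 1| * |M 1 0| :=
            mul_le_mul hcon.1 hcon.2 (by positivity) (by positivity)
          nlinarith [abs_pos.2 h0]
        have h01 : M 0 1 ≠ 0 := fun h => by rw [h] at hprod; nlinarith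
        have h10 : M 1 0 ≠ 0 := fun h => by rw [h] at hprod; nlinarith
        have hgen (g : B4) : (rep g * M * (rep g)⁻¹) 1 1 = -(rep g * M * (rep g)⁻¹) 0 0 := by
          have h := trace_conj (rep g) M
          rw [trace_fin_two, trace_fin_two, hM, add_neg_cancel] at h
          exact eq_neg_of_add_eq_zero_right h
        suffices h : ∃ g : B4, ((rep g * M * (rep g)⁻¹) 0 0).natAbs < n from
          h.imp fun g hg => ⟨hgen g, hg⟩
        have ha : (rep a * M * (rep a)⁻¹) 0 0 = M 0 0 - M 1 0 := by
          simp [rep_a, adjugate_fin_two, mul_apply, vecMul,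
            dotProduct, Fin.sum_univ_two]
          ring
        have ha' : (rep a⁻¹ * M * (rep a⁻¹)⁻¹) 0 0 = M 0 0 + M 1 0 := by
          simp [rep_a, adjugate_fin_two, mul_apply, vecMul,
            dotProduct, Fin.sum_univ_two]
        have hb : (rep b * M * (rep b)⁻¹) 0 0 = M 0 0 - M 0 1 := by
          simp [rep_b, adjugate_fin_two, mul_apply, vecMul,
            dotProduct, Fin.sum_univ_two]
          ring
        have hb' : (rep b⁻¹ * M * (rep b⁻¹)⁻¹) 0 0 = M 0 0 + M 0 1 := by
          simp [rep_b, adjugate_fin_two, mul_apply, vecMul,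
            dotProduct, Fin.sum_univ_two]
        by_contra! hcon
        have h₁ := hcon a
        have h₂ := hcon a⁻¹
        have h₃ := hcon b
        have h₄ := hcon b⁻¹
        rw [ha] at h₁
        rw [ha'] at h₂
        rw [hb] at h₃
        rw [hb'] at h₄
        omega
      obtain ⟨h, i, hi⟩ := ih _ hg' _ hg rfl
      refine ⟨h * g, i, ?_⟩
      rw [← hi, map_mul]
      group

open Matrix in
lemma exists_rep_conj_eq {M : SpecialLinearGroup (Fin 2) ℤ} (hM : M ^ 4 = 1) :
    ∃ h : B4, ∃ i : ℤ, rep h * M * (rep h)⁻¹ = rep delta ^ i := by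
  have hdet := M.det_coe
  rw [det_fin_two] at hdet
  set t := M 0 0 + M 1 1 with ht
  have hM' (i j : Fin 2) : (M.1 * M.1 * (M.1 * M.1)) i j = (1 : Matrix (Fin 2) (Fin 2) ℤ) i j := by
    have h : M * M * (M * M) = 1 := by
      rw [← hM, pow_succ, pow_three, mul_assoc, mul_assoc, mul_assoc]
    exact congrArg (fun N : SpecialLinearGroup (Fin 2) ℤ => N i j) h
  have h00 := hM' 0 0
  have h01 := hM' 0 1
  have h10 := hM' 1 0
  have h11 := hM' 1 1
  simp only [mul_apply, Fin.sum_univ_two, one_apply_eq, ne_eq, zero_ne_one, one_ne_zero,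
    not_false_eq_true, one_apply_ne] at h00 h01 h10 h11
  have k01 : (t ^ 2 - 2) * t * M 0 1 = 0 := by
    rw [ht]
    linear_combination h01 + 2 * M 0 1 * t * hdet
  have k10 : (t ^ 2 - 2) * t * M 1 0 = 0 := by
    rw [ht]
    linear_combination h10 + 2 * M 1 0 * t * hdet
  rcases eq_or_ne t 0 with h0 | h0
  · exact exists_rep_conj_eq_of_trace_eq_zero M (by linarith)
  have hne : (t ^ 2 - 2) * t ≠ 0 := by
    refine mul_ne_zero (fun ht => ?_) h0
    have h₁ : t < 2 := by nlinarith
    have h₂ : -2 < t := by nlinarith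
    clear_value t
    interval_cases t <;> omega
  have e01 := (mul_eq_zero.1 k01).resolve_left hne
  have e10 := (mul_eq_zero.1 k10).resolve_left hne
  rw [e01, zero_mul, sub_zero] at hdet
  rcases Int.mul_eq_one_iff_eq_one_or_neg_one.1 hdet with ⟨e00, e11⟩ | ⟨e00, e11⟩
  · refine ⟨1, 0, ?_⟩
    ext i j
    fin_cases i <;> fin_cases j <;> simp [e00, e01, e10, e11]
  · refine ⟨1, 2, ?_⟩
    ext i j
    fin_cases i <;> fin_cases j <;> simp [e00, e01, e10, e11, rep_delta, zpow_ofNat, pow_two]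

lemma map_eq_of_commGroup {G : Type*} [CommGroup G] (f : B4 →* G) : f b = f a ∧ f c = f a := by
  have key {g h : B4} (hgh : g * h * g = h * g * h) : f h = f g := by
    have h' := congrArg f hgh
    simp only [map_mul] at h'
    rw [mul_comm (f h) (f g)] at h'
    exact (mul_left_cancel h').symm
  exact ⟨key a_b_a, (key b_c_b).trans (key a_b_a)⟩

lemma eq_zpow_exponent {G : Type*} [CommGroup G] (f : B4 →* G) (g : B4) :
    f g = f a ^ (exponent g).toAdd := by
  obtain ⟨hb, hc⟩ := map_eq_of_commGroup f
  have h : f = (zpowersHom G (f a)).comp exponent :=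
    hom_ext (by simp [exponent]) (by simp [exponent, hb]) (by simp [exponent, hc])
  exact DFunLike.congr_fun h g

lemma exponent_mulAut (α : MulAut B4) :
    (∀ g, exponent (α g) = exponent g) ∨ ∀ g, exponent (α g) = (exponent g)⁻¹ := by
  have key (α : MulAut B4) (g : B4) : (exponent (α g)).toAdd =
      (exponent g).toAdd * (exponent (α a)).toAdd := by
    have h := eq_zpow_exponent (exponent.comp α.toMonoidHom) g
    exact (congrArg Multiplicative.toAdd h).trans (by simp)
  have hmn : (exponent (α a)).toAdd * (exponent (α⁻¹ a)).toAdd = 1 := by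
    have h := key α⁻¹ (α a)
    rw [← MulAut.mul_apply, inv_mul_cancel, MulAut.one_apply] at h
    rw [← h]
    simp [exponent]
  rcases Int.mul_eq_one_iff_eq_one_or_neg_one.1 hmn with ⟨h, -⟩ | ⟨h, -⟩
  · exact Or.inl fun g => Multiplicative.toAdd.injective (by rw [key, h, mul_one])
  · exact Or.inr fun g => Multiplicative.toAdd.injective (by rw [key, h, toAdd_inv]; ring)

lemma exponent_conj (g h : B4) : exponent (g * h * g⁻¹) = exponent h := by
  rw [map_mul, map_mul, map_inv, mul_comm (exponent g), mul_inv_cancel_right]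

section Automorphisms

variable {α : MulAut B4}

lemma exponent_inv_mulAut (hα : ∀ g, exponent (α g) = exponent g) (g : B4) :
    exponent (α⁻¹ g) = exponent g := by
  rw [← hα, ← MulAut.mul_apply, mul_inv_cancel, MulAut.one_apply]

lemma exponent_conj_mul (hα : ∀ g, exponent (α g) = exponent g) (h g : B4) :
    exponent ((MulAut.conj h * α) g) = exponent g := by
  rw [MulAut.mul_apply, MulAut.conj_apply, exponent_conj, hα]

lemma rep_mulAut_c (α : MulAut B4) : rep (α c) = rep (α a) := by
  apply eq_of_braid (B := rep (α b)) <;> simp only [← map_mul, a_b_a, b_c_b, a_c]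

lemma exists_mulAut_freeHom (hα : ∀ g, exponent (α g) = exponent g) (w : FreeGroup Bool) :
    ∃ w', α (freeHom w) = freeHom w' := by
  have hu : α (a * c⁻¹) ∈ freeHom.range := by
    have h1 : rep (α (a * c⁻¹)) = 1 := by
      rw [map_mul, map_mul, map_inv, map_inv, rep_mulAut_c, mul_inv_cancel]
    obtain ⟨k, w, hw⟩ := exists_eq_of_rep_eq_one h1
    have he := hα (a * c⁻¹)
    rw [hw, ← freeHom_of_false, map_mul, exponent_freeHom, exponent_freeHom, mul_one,
      exponent_delta_zpow, ofAdd_eq_one] at he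
    obtain rfl : k = 0 := by omega
    exact ⟨w, by simp [hw]⟩
  have h : α (freeHom w) ∈ freeHom.range := by
    induction w using FreeGroup.induction_on with
    | C1 => simp
    | of i =>
      cases i
      · rwa [freeHom_of_false]
      · rw [freeHom_of_true, map_mul, map_mul, map_inv]
        exact normal_range_freeHom.conj_mem _ hu _
    | inv_of i hi => rw [map_inv, map_inv]; exact inv_mem hi
    | mul v w hv hw => rw [map_mul, map_mul]; exact mul_mem hv hw
  obtain ⟨w', hw'⟩ := h
  exact ⟨w', hw'.symm⟩

lemma eq_one_of_fix (hα : ∀ g, exponent (α g) = exponent g) (hδ : α delta = delta)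
    (hu : α (a * c⁻¹) = a * c⁻¹) : α = 1 := by
  have hF (w : FreeGroup Bool) : α (freeHom w) = freeHom w := by
    have h : α.toMonoidHom.comp freeHom = freeHom := by
      ext i
      cases i <;> simp [hδ, -map_mul, hu, map_mul α delta, map_mul α (delta * _)]
    exact DFunLike.congr_fun h w
  ext1 g
  obtain ⟨k, hk⟩ := exists_eq_of_forall_commute (g := g⁻¹ * α g) fun w => by
    have h := hF (action g w)
    rw [freeHom_action, map_mul, map_mul, hF, map_inv] at h
    calc g⁻¹ * α g * freeHom w * (g⁻¹ * α g)⁻¹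
        = g⁻¹ * (α g * freeHom w * (α g)⁻¹) * g := by group
      _ = freeHom w := by rw [h]; group
  have he := congrArg exponent hk
  rw [map_mul, map_inv, hα, inv_mul_cancel, exponent_delta_zpow, eq_comm, ofAdd_eq_one] at he
  obtain rfl : k = 0 := by omega
  rw [mul_zero, zpow_zero, inv_mul_eq_one] at hk
  exact hk.symm

lemma exists_eq_conj_of_delta_fix (hα : ∀ g, exponent (α g) = exponent g)
    (hδ : α delta = delta) : ∃ g, α = MulAut.conj g := by
  obtain ⟨p, hp⟩ := exists_mulAut_freeHom hα (.of false)
  have hψ (w : FreeGroup Bool) :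
      freeHom (FreeGroup.lift (fun i => bif i then turn p else p) w) = α (freeHom w) := by
    have h : freeHom.comp (FreeGroup.lift fun i => bif i then turn p else p) =
        α.toMonoidHom.comp freeHom := by
      ext i
      cases i
      · simpa using hp.symm
      · simp [freeHom_turn, ← hp, hδ]
    exact DFunLike.congr_fun h w
  obtain ⟨k, hk⟩ : ∃ k : ℕ, p = (turn ^ k) (.of false) := by
    refine exists_eq_turn_pow (freeHom_injective ?_) ?_
    · have h : freeHom (turn (turn (.of false))) = freeHom (.of false)⁻¹ := by
        rw [turn_of_false, turn_of_true]
      rw [freeHom_turn, freeHom_turn] at h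
      replace h := congrArg α h
      simp only [map_mul, map_inv, hδ, hp] at h
      rwa [freeHom_turn, freeHom_turn, map_inv]
    · obtain ⟨w, hw⟩ := exists_mulAut_freeHom (exponent_inv_mulAut hα) (.of false)
      refine ⟨w, freeHom_injective ?_⟩
      rw [hψ, ← hw, ← MulAut.mul_apply, mul_inv_cancel, MulAut.one_apply]
  refine ⟨delta ^ k, ?_⟩
  rw [eq_comm, ← inv_mul_eq_one, ← map_inv]
  refine eq_one_of_fix (exponent_conj_mul hα _) ?_ ?_
  · rw [MulAut.mul_apply, hδ, MulAut.conj_apply]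
    group
  · rw [← freeHom_of_false, MulAut.mul_apply, hp, hk, ← action_delta, ← map_pow, freeHom_action,
      MulAut.conj_apply]
    group

lemma mulAut_delta_pow_four (hα : ∀ g, exponent (α g) = exponent g) :
    α (delta ^ 4) = delta ^ 4 := by
  obtain ⟨k, hk⟩ : ∃ k : ℤ, α (delta ^ 4) = delta ^ (4 * k) := by
    rw [← mem_center_iff, Subgroup.mem_center_iff]
    intro g
    have h := Subgroup.mem_center_iff.1 delta_pow_four_mem_center (α⁻¹ g)
    have := congrArg α h
    rwa [map_mul, map_mul, ← MulAut.mul_apply, mul_inv_cancel, MulAut.one_apply] at this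
  have he := hα (delta ^ 4)
  rw [hk, ← zpow_natCast, exponent_delta_zpow, exponent_delta_zpow] at he
  have he := congrArg Multiplicative.toAdd he
  obtain rfl : k = 1 := by simp at he; omega
  rw [hk, mul_one]
  rfl

lemma exists_eq_conj (hα : ∀ g, exponent (α g) = exponent g) : ∃ g, α = MulAut.conj g := by
  have hM : rep (α delta) ^ 4 = 1 := by
    rw [← map_pow, ← map_pow, mulAut_delta_pow_four hα, map_pow, rep_delta_pow_four]
  obtain ⟨h, i, hi⟩ := exists_rep_conj_eq hM
  have h1 : rep (h * α delta * h⁻¹ * delta ^ (-i)) = 1 := by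
    rw [map_mul, map_mul, map_mul, map_inv, hi, map_zpow, ← zpow_add, add_neg_cancel, zpow_zero]
  obtain ⟨k, w, hw⟩ := exists_eq_of_rep_eq_one h1
  have hk : i = 1 - 4 * k := by
    have he := congrArg (Multiplicative.toAdd ∘ exponent) hw
    simp [exponent_conj, hα, exponent_freeHom, exponent_delta] at he
    omega
  have hδ : (MulAut.conj h * α) delta = freeHom w * delta := by
    have hc := Subgroup.mem_center_iff.1 (mem_center_iff.2 ⟨k, rfl⟩) (freeHom w)
    rw [← hc, ← eq_mul_inv_iff_mul_eq, hk] at hw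
    rw [MulAut.mul_apply, MulAut.conj_apply, hw]
    group
  have hβ := exponent_conj_mul hα h
  generalize hβα : MulAut.conj h * α = β at hδ hβ
  obtain ⟨g, rfl⟩ : ∃ g, w = g * turn g⁻¹ := by
    refine exists_eq_mul_turn (freeHom_injective ?_)
    have h4 := mulAut_delta_pow_four hβ
    rw [map_pow, hδ] at h4
    simp only [map_mul, freeHom_turn, map_one]
    rw [← mul_right_cancel_iff (a := delta ^ 4), one_mul]
    conv_rhs => rw [← h4]
    simp only [pow_succ, pow_zero, one_mul, mul_assoc, inv_mul_cancel_left]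
  obtain ⟨g', hg'⟩ := exists_eq_conj_of_delta_fix (exponent_conj_mul hβ (freeHom g)⁻¹) (by
    rw [MulAut.mul_apply, hδ, MulAut.conj_apply, map_mul, freeHom_turn, map_inv]
    group)
  refine ⟨h⁻¹ * (freeHom g * g'), ?_⟩
  rw [map_mul, map_mul, ← hg', ← hβα, map_inv, map_inv]
  group

end Automorphisms

end B4

theorem statement11 (σ : MulAut B4) (hσa : σ a = a⁻¹) (hσb : σ b = b⁻¹) (hσc : σ c = c⁻¹)
    (τ : MulAut B4) (hτ : ∀ w, τ w = (a * c)⁻¹ * σ w * (a * c))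
    (φ : Multiplicative (ZMod 2) →* MulAut B4) (hφ : φ (Multiplicative.ofAdd 1) = τ) :
    Nonempty (MulAut B4 ≃*
      (B4 ⋊[φ] Multiplicative (ZMod 2)) ⧸
        Subgroup.normalClosure
          {(⟨x ^ 4, Multiplicative.ofAdd 0⟩ : B4 ⋊[φ] Multiplicative (ZMod 2))}) := by
  have hτe (w : B4) : exponent (τ w) = (exponent w)⁻¹ := by
    have h : exponent.comp σ.toMonoidHom = exponent⁻¹ :=
      hom_ext (by simp [hσa]) (by simp [hσb]) (by simp [hσc])
    have hw : exponent (σ w) = (exponent w)⁻¹ := DFunLike.congr_fun h w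
    rw [hτ, ← hw, ← exponent_conj (a * c)⁻¹ (σ w), inv_inv]
  let Φ : B4 ⋊[φ] Multiplicative (ZMod 2) →* MulAut B4 :=
    SemidirectProduct.lift MulAut.conj φ fun ε => by
      ext w g
      simp
  have hΦ (g : B4) (ε : Multiplicative (ZMod 2)) : Φ ⟨g, ε⟩ = MulAut.conj g * φ ε := rfl
  have hsurj : Function.Surjective Φ := by
    intro α
    rcases exponent_mulAut α with hα | hα
    · obtain ⟨g, rfl⟩ := exists_eq_conj hα
      exact ⟨⟨g, 1⟩, by rw [hΦ, map_one, mul_one]⟩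
    · obtain ⟨g, hg⟩ := exists_eq_conj (α := α * τ⁻¹) fun w => by
        rw [MulAut.mul_apply, hα, ← hτe, ← MulAut.mul_apply, mul_inv_cancel, MulAut.one_apply]
      exact ⟨⟨g, .ofAdd 1⟩, by rw [hΦ, hφ, ← hg, inv_mul_cancel_right]⟩
  have hker : Φ.ker = Subgroup.normalClosure {⟨x ^ 4, .ofAdd 0⟩} := by
    apply le_antisymm
    · rintro ⟨g, ε⟩ hg
      rw [MonoidHom.mem_ker, hΦ] at hg
      obtain rfl | rfl : ε = .ofAdd 0 ∨ ε = .ofAdd 1 :=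
        (by decide : ∀ ε : Multiplicative (ZMod 2), ε = .ofAdd 0 ∨ ε = .ofAdd 1) ε
      · have hc : g ∈ Subgroup.center B4 := by
          rw [Subgroup.mem_center_iff]
          intro h
          have h' := DFunLike.congr_fun hg h
          rw [ofAdd_zero, map_one, mul_one, MulAut.conj_apply, MulAut.one_apply,
            mul_inv_eq_iff_eq_mul] at h'
          exact h'.symm
        obtain ⟨k, rfl⟩ := mem_center_iff.1 hc
        have e (g : B4) : (⟨g, .ofAdd 0⟩ : B4 ⋊[φ] Multiplicative (ZMod 2)) =
          SemidirectProduct.inl g := rfl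
        rw [e, e, zpow_mul, map_zpow, x_pow_four]
        exact zpow_mem (Subgroup.subset_normalClosure (Set.mem_singleton _)) k
      · have h := congrArg (fun β : MulAut B4 => exponent (β delta)) hg
        simp [hφ, hτe, exponent_conj, exponent_delta] at h
        exact absurd h (by decide)
    · refine Subgroup.normalClosure_le_normal (Set.singleton_subset_iff.2 ?_)
      rw [SetLike.mem_coe, MonoidHom.mem_ker, hΦ, ofAdd_zero, map_one, mul_one, x_pow_four]
      ext1 g
      rw [MulAut.conj_apply, ← Subgroup.mem_center_iff.1 delta_pow_four_mem_center,
        mul_inv_cancel_right, MulAut.one_apply]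
  exact ⟨((QuotientGroup.quotientMulEquivOfEq hker).symm.trans
    (QuotientGroup.quotientKerEquivOfSurjective Φ hsurj)).symm⟩
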